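/- arXiv:2510.09552 — 2 statements merged into one kernel-verified Lean document; each statement's English description precedes it below -/
import Mathlib

section
/- Let 0 → Q --α--> P --β--> T → 0 be a short exact sequence of finitely generated free abelian groups. Then the sequence 0 → Λ³Q → Λ²Q ⊗ P → Q ⊗ S²(P) → S³(P) → S³(T) → 0 is exact, where the maps are: a∧b∧c ↦ (b∧c)⊗α(a) − (a∧c)⊗α(b) + (a∧b)⊗α(c); (a∧b)⊗p ↦ a⊗(α(b)·p) − b⊗(α(a)·p); a⊗s ↦ α(a)·s (product in S³(P)); and the map S³(β) induced by β. -/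
noncomputable section

open TensorProduct

section Sym2

variable (k : Type*) [CommRing k] (V : Type*) [AddCommGroup V] [Module k V]

/-- The submodule of `V ⊗ V` generated by the elements `u ⊗ v - v ⊗ u`. -/
def symSub : Submodule k (V ⊗[k] V) :=
  Submodule.span k {w | ∃ u v : V, w = u ⊗ₜ[k] v - v ⊗ₜ[k] u}

/-- The symmetric square `S²(V)`: the quotient of `V ⊗ V` by all `u ⊗ v - v ⊗ u`. -/
abbrev Sym2M : Type _ := (V ⊗[k] V) ⧸ symSub k V

variable {k V}

/-- The product `u·v` in `S²(V)`, i.e. the image of `u ⊗ v`. -/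
def symMk (u v : V) : Sym2M k V := Submodule.Quotient.mk (u ⊗ₜ[k] v)

end Sym2

/-- The wedge `a ∧ b`, an element of the second exterior power `⋀[ℤ]² Q`. -/
def wedge2 {Q : Type*} [AddCommGroup Q] [Module ℤ Q] (a b : Q) : ⋀[ℤ]^2 Q :=
  ⟨ExteriorAlgebra.ιMulti ℤ 2 ![a, b],
    ExteriorAlgebra.ιMulti_range ℤ 2 (Set.mem_range_self _)⟩

section Sym3

variable (k : Type*) [CommRing k] (V : Type*) [AddCommGroup V] [Module k V]

/-- The submodule of `V ⊗ V ⊗ V` generated by all differences of a tensor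
`u₁ ⊗ u₂ ⊗ u₃` and its permutations. -/
def sym3Sub : Submodule k (V ⊗[k] (V ⊗[k] V)) :=
  Submodule.span k {w | ∃ (v : Fin 3 → V) (σ : Equiv.Perm (Fin 3)),
    w = v 0 ⊗ₜ[k] (v 1 ⊗ₜ[k] v 2) - v (σ 0) ⊗ₜ[k] (v (σ 1) ⊗ₜ[k] v (σ 2))}

/-- The symmetric cube `S³(V)`. -/
abbrev Sym3M : Type _ := (V ⊗[k] (V ⊗[k] V)) ⧸ sym3Sub k V

variable {k V}

/-- The product `u·v·w` in `S³(V)`, i.e. the image of `u ⊗ v ⊗ w`. -/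
def sym3Mk (u v w : V) : Sym3M k V := Submodule.Quotient.mk (u ⊗ₜ[k] (v ⊗ₜ[k] w))

end Sym3

/-- The wedge `a ∧ b ∧ c`, an element of the third exterior power `⋀[ℤ]³ Q`. -/
def wedge3 {Q : Type*} [AddCommGroup Q] [Module ℤ Q] (a b c : Q) : ⋀[ℤ]^3 Q :=
  ⟨ExteriorAlgebra.ιMulti ℤ 3 ![a, b, c],
    ExteriorAlgebra.ιMulti_range ℤ 3 (Set.mem_range_self _)⟩

section SymmetricPowers

variable {k V M : Type*} [CommRing k] [AddCommGroup V] [Module k V] [AddCommGroup M] [Module k M]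

/-- The product `V × V → S²(V)` as a bilinear map. -/
def symMkHom : V →ₗ[k] V →ₗ[k] Sym2M k V :=
  (TensorProduct.mk k V V).compr₂ (symSub k V).mkQ

lemma symMk_comm (u v : V) : (symMk u v : Sym2M k V) = symMk v u :=
  (Submodule.Quotient.eq _).2 (Submodule.subset_span ⟨u, v, rfl⟩)

lemma sym2M_hom_ext {f g : Sym2M k V →ₗ[k] M} (h : ∀ u v, f (symMk u v) = g (symMk u v)) :
    f = g :=
  Submodule.linearMap_qext _ (TensorProduct.ext' fun u v ↦ h u v)

/-- The linear map on `S²(V)` induced by a symmetric bilinear map. -/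
def sym2MLift (B : V →ₗ[k] V →ₗ[k] M) (hB : ∀ u v, B u v = B v u) : Sym2M k V →ₗ[k] M :=
  (symSub k V).liftQ (TensorProduct.lift B) <| by
    refine Submodule.span_le.2 ?_
    rintro _ ⟨u, v, rfl⟩
    simp [hB u v]

lemma sym2MLift_symMk (B : V →ₗ[k] V →ₗ[k] M) (hB : ∀ u v, B u v = B v u) (u v : V) :
    sym2MLift B hB (symMk u v) = B u v := rfl

/-- The product `V × V × V → S³(V)` as a trilinear map. -/
def sym3MkHom : V →ₗ[k] V →ₗ[k] V →ₗ[k] Sym3M k V :=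
  LinearMap.mk₂ k (fun u v ↦ (sym3Sub k V).mkQ ∘ₗ TensorProduct.mk k V (V ⊗[k] V) u ∘ₗ
      TensorProduct.mk k V V v)
    (fun _ _ _ ↦ by ext; simp)
    (fun _ _ _ ↦ by ext; simp)
    (fun _ _ _ ↦ by ext; simp [TensorProduct.tmul_add])
    (fun _ _ _ ↦ by ext; simp)

lemma sym3MkHom_apply (u v w : V) : sym3MkHom (k := k) u v w = sym3Mk u v w := rfl

lemma sym3Mk_swap_left (u v w : V) : (sym3Mk u v w : Sym3M k V) = sym3Mk v u w :=
  (Submodule.Quotient.eq _).2 (Submodule.subset_span ⟨![u, v, w], Equiv.swap 0 1, rfl⟩)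

lemma sym3Mk_swap_right (u v w : V) : (sym3Mk u v w : Sym3M k V) = sym3Mk u w v :=
  (Submodule.Quotient.eq _).2 (Submodule.subset_span ⟨![u, v, w], Equiv.swap 1 2, rfl⟩)

lemma sym3M_hom_ext {f g : Sym3M k V →ₗ[k] M}
    (h : ∀ u v w, f (sym3Mk u v w) = g (sym3Mk u v w)) : f = g := by
  refine Submodule.linearMap_qext _ ?_
  ext u v w
  exact h u v w

/-- The linear map on `S³(V)` induced by a symmetric trilinear map. -/
def sym3MLift (F : V →ₗ[k] V →ₗ[k] V →ₗ[k] M) (h₁ : ∀ u v w, F u v w = F v u w)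
    (h₂ : ∀ u v w, F u v w = F u w v) : Sym3M k V →ₗ[k] M :=
  (sym3Sub k V).liftQ
    (TensorProduct.lift (TensorProduct.uncurry (RingHom.id k) V V M ∘ₗ F)) <| by
    refine Submodule.span_le.2 ?_
    rintro _ ⟨v, σ, rfl⟩
    have key : ∀ i j l : Fin 3, i ≠ j → i ≠ l → j ≠ l →
        F (v i) (v j) (v l) = F (v 0) (v 1) (v 2) := by
      intro i j l hij hil hjl
      fin_cases i <;> fin_cases j <;> fin_cases l <;> simp at hij hil hjl ⊢
      · exact h₂ _ _ _
      · exact h₁ _ _ _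
      · rw [h₂, h₁]
      · rw [h₁, h₂]
      · rw [h₁, h₂, h₁]
    have := key (σ 0) (σ 1) (σ 2) (by simp) (by simp) (by simp)
    simp [this]

lemma sym3MLift_sym3Mk (F : V →ₗ[k] V →ₗ[k] V →ₗ[k] M) (h₁ : ∀ u v w, F u v w = F v u w)
    (h₂ : ∀ u v w, F u v w = F u w v) (u v w : V) :
    sym3MLift F h₁ h₂ (sym3Mk u v w) = F u v w := rfl

end SymmetricPowers

section Exactness

variable {k : Type*} [CommRing k]

lemma exact_of_comp_eq_mkQ {A B C : Type*} [AddCommGroup A] [Module k A] [AddCommGroup B]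
    [Module k B] [AddCommGroup C] [Module k C] {f : A →ₗ[k] B} {g : B →ₗ[k] C}
    (h : C →ₗ[k] B ⧸ LinearMap.range f) (hgf : g ∘ₗ f = 0)
    (hg : h ∘ₗ g = (LinearMap.range f).mkQ) : Function.Exact f g := by
  intro y
  refine ⟨fun hy ↦ ?_, ?_⟩
  · have := LinearMap.congr_fun hg y
    rw [LinearMap.comp_apply, hy, map_zero, eq_comm, Submodule.mkQ_apply,
      Submodule.Quotient.mk_eq_zero] at this
    exact this
  · rintro ⟨x, rfl⟩
    exact LinearMap.congr_fun hgf x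

variable {Q P T M : Type*} [AddCommGroup Q] [Module k Q] [AddCommGroup P] [Module k P]
  [AddCommGroup T] [Module k T] [AddCommGroup M] [Module k M]

/-- If `P = Q ⊕ T` with projection `π` onto `Q`, then a trilinear map on `Q × P × P` which is
symmetric in all arguments in `Q` or in `P` extends to `S³(P)`, by zero on `S³(T)`. -/
lemma exists_sym3M_extension (α : Q →ₗ[k] P) (π : P →ₗ[k] Q) (hπ : π ∘ₗ α = .id)
    (G : Q →ₗ[k] P →ₗ[k] P →ₗ[k] M) (hG : ∀ q p p', G q p p' = G q p' p)
    (hG' : ∀ q q' p, G q (α q') p = G q' (α q) p) :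
    ∃ g : Sym3M k P →ₗ[k] M, ∀ q p p', g (sym3Mk (α q) p p') = G q p p' := by
  have hπ' (q : Q) : π (α q) = q := LinearMap.congr_fun hπ q
  let τ : P →ₗ[k] P := .id - α ∘ₗ π
  have hτ (p : P) : τ p = p - α (π p) := rfl
  let F : P →ₗ[k] P →ₗ[k] P →ₗ[k] M := LinearMap.mk₂ k
    (fun p₁ p₂ ↦ G (π p₁) p₂ + G (π p₂) (τ p₁) + (G.flip (τ p₁)).flip (τ p₂) ∘ₗ π)
    (fun _ _ _ ↦ by ext; simp; abel) (fun _ _ _ ↦ by ext; simp)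
    (fun _ _ _ ↦ by ext; simp; abel) (fun _ _ _ ↦ by ext; simp)
  have hF (p₁ p₂ p₃ : P) : F p₁ p₂ p₃ =
    G (π p₁) p₂ p₃ + G (π p₂) (τ p₁) p₃ + G (π p₃) (τ p₁) (τ p₂) := rfl
  refine ⟨sym3MLift F ?_ ?_, fun q p p' ↦ ?_⟩
  · intro u v w
    simp only [hF, hτ, map_sub, LinearMap.sub_apply]
    rw [hG' (π v) (π u) w, hG (π w) u v, hG (π w) (α (π u)) v, hG (π w) u (α (π v)),
      hG (π w) (α (π u)) (α (π v))]
    abel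
  · intro u v w
    simp only [hF, hτ, map_sub, LinearMap.sub_apply]
    rw [hG (π u) v w, hG (π w) u (α (π v)), hG' (π w) (π v) u, hG (π v) (α (π w)) u,
      hG (π w) (α (π u)) (α (π v)), hG' (π w) (π v) (α (π u)), hG (π v) (α (π w)) (α (π u))]
    abel
  · rw [sym3MLift_sym3Mk, hF]
    simp [hτ, hπ']

/-- A contraction of the Koszul complex in degree one: it moves the smallest basis vector of `Q`
occurring in a monomial into the exterior factor. -/
lemma exists_koszul_contraction {n : ℕ} {κ : Type*} (b : Module.Basis (Fin n) k Q)
    (c : Module.Basis (Fin n ⊕ κ) k P) (α : Q →ₗ[k] P) (hα : ∀ i, α (b i) = c (.inl i))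
    (W : Q →ₗ[k] Q →ₗ[k] P →ₗ[k] M) (hW : ∀ q, W q q = 0)
    (hW' : ∀ q₁ q₂ q₃, W q₁ q₂ (α q₃) + W q₂ q₃ (α q₁) + W q₃ q₁ (α q₂) = 0) :
    ∃ g : Q ⊗[k] Sym2M k P →ₗ[k] M, ∀ q q' p,
      g (q ⊗ₜ symMk (α q') p) - g (q' ⊗ₜ symMk (α q) p) = W q q' p := by
  have hW₂ (q q' : Q) (p : P) : W q q' p = - W q' q p := by
    have h := congr($(hW (q + q')) p)
    simp only [map_add, LinearMap.add_apply, hW, zero_add, add_zero, LinearMap.zero_apply] at h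
    exact eq_neg_of_add_eq_zero_right h
  let r : Fin n ⊕ κ → ℕ := Sum.elim (fun i ↦ i) (fun _ ↦ n)
  let m : Fin n ⊕ κ → Q := Sum.elim b (fun _ ↦ 0)
  let ψ (i : Fin n) (x y : Fin n ⊕ κ) : M :=
    if i ≤ r x ∧ i ≤ r y then 0
    else if r x ≤ r y then W (b i) (m x) (c y) else W (b i) (m y) (c x)
  have hψ (i : Fin n) (x y : Fin n ⊕ κ) : ψ i x y = ψ i y x := by
    rcases x with j | x <;> rcases y with l | y <;> simp only [ψ, r, m, Sum.elim_inl, Sum.elim_inr]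
    · rcases lt_trichotomy j l with h | rfl | h
      · have h' : (j : ℕ) < l := h
        simp [h'.le, h'.not_ge, and_comm]
      · rfl
      · have h' : (l : ℕ) < j := h
        simp [h'.le, h'.not_ge, and_comm]
    · simp [j.2.le, j.2.not_ge, and_comm]
    · simp [l.2.le, l.2.not_ge, and_comm]
    · simp
  let B (i : Fin n) : P →ₗ[k] P →ₗ[k] M := c.constr k fun x ↦ c.constr k fun y ↦ ψ i x y
  have hB (i : Fin n) (x y : Fin n ⊕ κ) : B i (c x) (c y) = ψ i x y := by simp [B]
  have hB' (i : Fin n) : B i = (B i).flip :=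
    c.ext fun x ↦ c.ext fun y ↦ by rw [LinearMap.flip_apply, hB, hB, hψ]
  let g : Q ⊗[k] Sym2M k P →ₗ[k] M := TensorProduct.lift <|
    b.constr k fun i ↦ sym2MLift (B i) fun u v ↦ congr($(hB' i) u v)
  have hg (i : Fin n) (x y : Fin n ⊕ κ) : g (b i ⊗ₜ symMk (c x) (c y)) = ψ i x y := by
    simp [g, sym2MLift_symMk, hB]
  let S : Q →ₗ[k] Q →ₗ[k] P →ₗ[k] M := LinearMap.mk₂ k
    (fun q q' ↦ g ∘ₗ TensorProduct.mk k Q _ q ∘ₗ symMkHom (α q'))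
    (fun _ _ _ ↦ by ext; simp)
    (fun _ _ _ ↦ by ext; simp)
    (fun _ _ _ ↦ by ext; simp [TensorProduct.tmul_add])
    (fun _ _ _ ↦ by ext; simp)
  have hS (q q' : Q) (p : P) : S q q' p = g (q ⊗ₜ symMk (α q') p) := rfl
  have hSW : S - S.flip = W := by
    refine b.ext fun i ↦ b.ext fun j ↦ c.ext fun y ↦ ?_
    simp only [LinearMap.sub_apply, LinearMap.flip_apply, hS, hα, hg]
    rcases y with l | y
    · have h3 := hW' (b i) (b j) (b l)
      simp only [hα] at h3
      simp only [ψ, r, m, Sum.elim_inl]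
      have e1 := hW₂ (b i) (b j) (c (.inl l))
      have e2 := hW₂ (b i) (b l) (c (.inl j))
      rcases lt_trichotomy i j with h | rfl | h
      · have h' : (i : ℕ) < j := h
        by_cases hil : (i : ℕ) ≤ l
        · simp [h'.le, h'.not_ge, hil, e1]
        · have hjl : ¬ (j : ℕ) ≤ l := by omega
          simp only [h'.le, h'.not_ge, hil, hjl]
          grind
      · simp [hW]
      · have h' : (j : ℕ) < i := h
        by_cases hjl : (j : ℕ) ≤ l
        · simp [h'.le, h'.not_ge, hjl]
        · have hil : ¬ (i : ℕ) ≤ l := by omega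
          simp only [h'.le, h'.not_ge, hil, hjl]
          grind
    · simp only [ψ, r, m, Sum.elim_inl, Sum.elim_inr]
      have e1 := hW₂ (b i) (b j) (c (.inr y))
      rcases lt_trichotomy i j with h | rfl | h
      · have h' : (i : ℕ) < j := h
        simp [h'.le, h'.not_ge, i.2.le, j.2.le, e1]
      · simp [hW]
      · have h' : (j : ℕ) < i := h
        simp [h'.le, h'.not_ge, i.2.le, j.2.le]
  refine ⟨g, fun q q' p ↦ ?_⟩
  rw [← hSW]
  rfl

variable {L₂ L₃ : Type*} [AddCommGroup L₂] [Module k L₂] [AddCommGroup L₃] [Module k L₃]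

lemma koszul_exact_two {n : ℕ} {κ : Type*} (b : Module.Basis (Fin n) k Q)
    (c : Module.Basis (Fin n ⊕ κ) k P) (w₂ : Q →ₗ[k] Q →ₗ[k] L₂) (hw₂ : ∀ a, w₂ a a = 0)
    (hs₂ : Submodule.span k {x | ∃ a b, x = w₂ a b} = ⊤) (w₃ : Q → Q → Q → L₃)
    (hs₃ : Submodule.span k {x | ∃ a b c, x = w₃ a b c} = ⊤)
    (α : Q →ₗ[k] P) (hα : ∀ i, α (b i) = c (.inl i))
    (f₁ : L₃ →ₗ[k] L₂ ⊗[k] P) (f₂ : L₂ ⊗[k] P →ₗ[k] Q ⊗[k] Sym2M k P)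
    (hf₁ : ∀ a b c : Q, f₁ (w₃ a b c) = w₂ b c ⊗ₜ[k] α a -
      w₂ a c ⊗ₜ[k] α b + w₂ a b ⊗ₜ[k] α c)
    (hf₂ : ∀ (a b : Q) (p : P), f₂ (w₂ a b ⊗ₜ[k] p) =
      a ⊗ₜ[k] symMk (α b) p - b ⊗ₜ[k] symMk (α a) p) :
    Function.Exact f₁ f₂ := by
  have hw₂' (a b : Q) : w₂ a b = - w₂ b a := by
    have h := hw₂ (a + b)
    simp only [map_add, LinearMap.add_apply, hw₂, zero_add, add_zero] at h
    exact eq_neg_of_add_eq_zero_right h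
  let W : Q →ₗ[k] Q →ₗ[k] P →ₗ[k] (L₂ ⊗[k] P ⧸ LinearMap.range f₁) :=
    w₂.compr₂ ((TensorProduct.mk k L₂ P).compr₂ (LinearMap.range f₁).mkQ)
  have hW (a b : Q) (p : P) :
    W a b p = (LinearMap.range f₁).mkQ (w₂ a b ⊗ₜ p) := rfl
  obtain ⟨g, hg⟩ := exists_koszul_contraction b c α hα W
    (fun q ↦ by ext p; rw [hW, hw₂, TensorProduct.zero_tmul, map_zero]; rfl)
    (fun q₁ q₂ q₃ ↦ by
      simp only [hW]
      rw [← map_add, ← map_add, Submodule.mkQ_apply, Submodule.Quotient.mk_eq_zero]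
      refine ⟨w₃ q₁ q₂ q₃, ?_⟩
      rw [hf₁, hw₂' q₁ q₃, TensorProduct.neg_tmul]
      abel)
  refine exact_of_comp_eq_mkQ g ?_ ?_
  · refine LinearMap.ext_on hs₃ ?_
    rintro _ ⟨a, b, c, rfl⟩
    rw [LinearMap.comp_apply, hf₁, map_add, map_sub, hf₂, hf₂, hf₂, symMk_comm (α c) (α a),
      symMk_comm (α b) (α a), symMk_comm (α c) (α b), LinearMap.zero_apply]
    abel
  · refine TensorProduct.ext (LinearMap.ext_on hs₂ ?_)
    rintro _ ⟨a, b, rfl⟩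
    refine LinearMap.ext fun p ↦ ?_
    change g (f₂ (w₂ a b ⊗ₜ p)) = (LinearMap.range f₁).mkQ (w₂ a b ⊗ₜ p)
    rw [hf₂, map_sub, hg, hW]

lemma koszul_exact_one (w₂ : Q →ₗ[k] Q →ₗ[k] L₂)
    (hs₂ : Submodule.span k {x | ∃ a b, x = w₂ a b} = ⊤)
    (α : Q →ₗ[k] P) (π : P →ₗ[k] Q) (hπ : π ∘ₗ α = .id)
    (f₂ : L₂ ⊗[k] P →ₗ[k] Q ⊗[k] Sym2M k P) (f₃ : Q ⊗[k] Sym2M k P →ₗ[k] Sym3M k P)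
    (hf₂ : ∀ (a b : Q) (p : P), f₂ (w₂ a b ⊗ₜ[k] p) =
      a ⊗ₜ[k] symMk (α b) p - b ⊗ₜ[k] symMk (α a) p)
    (hf₃ : ∀ (a : Q) (p p' : P), f₃ (a ⊗ₜ[k] symMk p p') = sym3Mk (α a) p p') :
    Function.Exact f₂ f₃ := by
  let G : Q →ₗ[k] P →ₗ[k] P →ₗ[k] (Q ⊗[k] Sym2M k P ⧸ LinearMap.range f₂) :=
    LinearMap.mk₂ k (fun q p ↦ (LinearMap.range f₂).mkQ ∘ₗ TensorProduct.mk k Q _ q ∘ₗ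
        symMkHom p)
      (fun _ _ _ ↦ by ext; simp)
      (fun _ _ _ ↦ by ext; simp)
      (fun _ _ _ ↦ by ext; simp [TensorProduct.tmul_add])
      (fun _ _ _ ↦ by ext; simp)
  have hG (q : Q) (p p' : P) : G q p p' = (LinearMap.range f₂).mkQ (q ⊗ₜ symMk p p') := rfl
  obtain ⟨g, hg⟩ := exists_sym3M_extension α π hπ G
    (fun q p p' ↦ by rw [hG, hG, symMk_comm])
    (fun q q' p ↦ by
      rw [hG, hG, ← sub_eq_zero, ← map_sub, Submodule.mkQ_apply, Submodule.Quotient.mk_eq_zero]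
      exact ⟨_, hf₂ q q' p⟩)
  refine exact_of_comp_eq_mkQ g ?_ ?_
  · refine TensorProduct.ext (LinearMap.ext_on hs₂ ?_)
    rintro _ ⟨a, b, rfl⟩
    refine LinearMap.ext fun p ↦ ?_
    change f₃ (f₂ (w₂ a b ⊗ₜ p)) = 0
    rw [hf₂, map_sub, hf₃, hf₃, sym3Mk_swap_left (α a) (α b), sub_self]
  · refine TensorProduct.ext (LinearMap.ext fun q ↦ sym2M_hom_ext fun p p' ↦ ?_)
    simp [hf₃, hg, hG]

lemma koszul_exact_zero (α : Q →ₗ[k] P) (β : P →ₗ[k] T) (hαβ : Function.Exact α β)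
    (σ : T →ₗ[k] P) (hσ : β ∘ₗ σ = .id)
    (f₃ : Q ⊗[k] Sym2M k P →ₗ[k] Sym3M k P) (f₄ : Sym3M k P →ₗ[k] Sym3M k T)
    (hf₃ : ∀ (a : Q) (p p' : P), f₃ (a ⊗ₜ[k] symMk p p') = sym3Mk (α a) p p')
    (hf₄ : ∀ p p' p'' : P, f₄ (sym3Mk p p' p'') = sym3Mk (β p) (β p') (β p'')) :
    Function.Exact f₃ f₄ := by
  have hσ' (t : T) : β (σ t) = t := LinearMap.congr_fun hσ t
  have hβα (q : Q) : β (α q) = 0 := hαβ.apply_apply_eq_zero q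
  let F : T →ₗ[k] T →ₗ[k] T →ₗ[k] (Sym3M k P ⧸ LinearMap.range f₃) :=
    LinearMap.mk₂ k (fun t t' ↦ (LinearMap.range f₃).mkQ ∘ₗ sym3MkHom (σ t) (σ t') ∘ₗ σ)
      (fun _ _ _ ↦ by ext; simp) (fun _ _ _ ↦ by ext; simp)
      (fun _ _ _ ↦ by ext; simp) (fun _ _ _ ↦ by ext; simp)
  have hF (t t' t'' : T) : F t t' t'' =
    (LinearMap.range f₃).mkQ (sym3Mk (σ t) (σ t') (σ t'')) := rfl
  have hmk (p p' u v : P) (h : β p = β p') : (LinearMap.range f₃).mkQ (sym3Mk p u v) =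
      (LinearMap.range f₃).mkQ (sym3Mk p' u v) := by
    obtain ⟨q, hq⟩ := (hαβ (p - p')).1 (by simp [h])
    rw [← sub_eq_zero, ← map_sub, Submodule.mkQ_apply, Submodule.Quotient.mk_eq_zero]
    refine ⟨q ⊗ₜ symMk u v, ?_⟩
    rw [hf₃, hq]
    simp [← sym3MkHom_apply]
  refine exact_of_comp_eq_mkQ (sym3MLift F (fun u v w ↦ ?_) (fun u v w ↦ ?_)) ?_ ?_
  · rw [hF, hF, sym3Mk_swap_left]
  · rw [hF, hF, sym3Mk_swap_right]
  · refine TensorProduct.ext (LinearMap.ext fun q ↦ sym2M_hom_ext fun p p' ↦ ?_)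
    change f₄ (f₃ (q ⊗ₜ symMk p p')) = 0
    rw [hf₃, hf₄, hβα, ← sym3MkHom_apply, map_zero]
    rfl
  · refine sym3M_hom_ext fun u v w ↦ ?_
    rw [LinearMap.comp_apply, hf₄, sym3MLift_sym3Mk, hF, hmk _ u _ _ (hσ' _), sym3Mk_swap_left,
      hmk _ v _ _ (hσ' _), sym3Mk_swap_right, sym3Mk_swap_left, hmk _ w _ _ (hσ' _),
      sym3Mk_swap_right w v u, sym3Mk_swap_left w u v, sym3Mk_swap_right u w v]

lemma sym3M_map_surjective (β : P →ₗ[k] T) (hβ : Function.Surjective β)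
    (f₄ : Sym3M k P →ₗ[k] Sym3M k T)
    (hf₄ : ∀ p p' p'' : P, f₄ (sym3Mk p p' p'') = sym3Mk (β p) (β p') (β p'')) :
    Function.Surjective f₄ := by
  refine LinearMap.range_eq_top.1 ?_
  refine LinearMap.range_eq_top_of_cancel fun u v huv ↦ sym3M_hom_ext fun t t' t'' ↦ ?_
  obtain ⟨p, rfl⟩ := hβ t
  obtain ⟨p', rfl⟩ := hβ t'
  obtain ⟨p'', rfl⟩ := hβ t''
  rw [← hf₄]
  exact LinearMap.congr_fun huv _

end Exactness

section ExteriorPowers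

open exteriorPower

variable {k Q P M T : Type*} [CommRing k] [AddCommGroup Q] [Module k Q] [AddCommGroup P]
  [Module k P] [AddCommGroup M] [Module k M] [AddCommGroup T] [Module k T]

lemma coe_ιMulti_two (a b : Q) : (ιMulti k 2 ![a, b] : ExteriorAlgebra k Q) =
    ExteriorAlgebra.ι k a * ExteriorAlgebra.ι k b := by
  simp [ExteriorAlgebra.ιMulti_apply]

lemma coe_ιMulti_three (a b c : Q) : (ιMulti k 3 ![a, b, c] : ExteriorAlgebra k Q) =
    ExteriorAlgebra.ι k a * (ExteriorAlgebra.ι k b * ExteriorAlgebra.ι k c) := by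
  simp [ExteriorAlgebra.ιMulti_apply]

/-- The wedge product `Q × Q → Λ²Q` as a bilinear map. -/
def exteriorPower.wedgeHom : Q →ₗ[k] Q →ₗ[k] ⋀[k]^2 Q :=
  LinearMap.mk₂ k (fun a b ↦ ιMulti k 2 ![a, b])
    (fun _ _ _ ↦ Subtype.ext (by simp only [Submodule.coe_add, coe_ιMulti_two, map_add, add_mul]))
    (fun _ _ _ ↦ Subtype.ext (by
      simp only [Submodule.coe_smul, coe_ιMulti_two, map_smul, smul_mul_assoc]))
    (fun _ _ _ ↦ Subtype.ext (by simp only [Submodule.coe_add, coe_ιMulti_two, map_add, mul_add]))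
    (fun _ _ _ ↦ Subtype.ext (by
      simp only [Submodule.coe_smul, coe_ιMulti_two, map_smul, mul_smul_comm]))

lemma ιMulti_two_self (a : Q) : ιMulti k 2 ![a, a] = 0 :=
  Subtype.ext (by rw [coe_ιMulti_two, ExteriorAlgebra.ι_sq_zero, Submodule.coe_zero])

lemma ExteriorAlgebra.ι_mul_ι_swap (a b : Q) : ExteriorAlgebra.ι k a * ExteriorAlgebra.ι k b =
    - (ExteriorAlgebra.ι k b * ExteriorAlgebra.ι k a) :=
  eq_neg_of_add_eq_zero_left (ExteriorAlgebra.ι_add_mul_swap a b)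

lemma span_ιMulti_two :
    Submodule.span k {x : ⋀[k]^2 Q | ∃ a b, x = wedgeHom (k := k) a b} = ⊤ := by
  rw [← ιMulti_span]
  congr 1
  ext x
  constructor
  · rintro ⟨a, b, rfl⟩
    exact ⟨_, rfl⟩
  · rintro ⟨v, rfl⟩
    refine ⟨v 0, v 1, congrArg _ ?_⟩
    ext i
    fin_cases i <;> rfl

lemma span_ιMulti_three :
    Submodule.span k {x : ⋀[k]^3 Q | ∃ a b c, x = ιMulti k 3 ![a, b, c]} = ⊤ := by
  rw [← ιMulti_span]
  congr 1
  ext x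
  constructor
  · rintro ⟨a, b, c, rfl⟩
    exact ⟨_, rfl⟩
  · rintro ⟨v, rfl⟩
    refine ⟨v 0, v 1, v 2, congrArg _ ?_⟩
    ext i
    fin_cases i <;> rfl

/-- The composite of the comultiplication `Λ³Q → Λ²Q ⊗ Q` with the multiplication to `Λ³Q` is
multiplication by three, so the comultiplication is injective when `Q` is free. -/
lemma koszul_injective [IsDomain k] [CharZero k] [Module.Free k Q] (α : Q →ₗ[k] P)
    (π : P →ₗ[k] Q) (hπ : π ∘ₗ α = .id) (f : ⋀[k]^3 Q →ₗ[k] (⋀[k]^2 Q) ⊗[k] P)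
    (hf : ∀ a b c : Q, f (ιMulti k 3 ![a, b, c]) = ιMulti k 2 ![b, c] ⊗ₜ[k] α a -
      ιMulti k 2 ![a, c] ⊗ₜ[k] α b + ιMulti k 2 ![a, b] ⊗ₜ[k] α c) :
    Function.Injective f := by
  have hπ' (q : Q) : π (α q) = q := LinearMap.congr_fun hπ q
  let μ : (⋀[k]^2 Q) ⊗[k] P →ₗ[k] ExteriorAlgebra k Q := TensorProduct.lift <|
    (LinearMap.mul k (ExteriorAlgebra k Q)).compl₁₂ (⋀[k]^2 Q).subtype (ExteriorAlgebra.ι k ∘ₗ π)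
  have hμ (x : ⋀[k]^2 Q) (p : P) : μ (x ⊗ₜ p) = x * ExteriorAlgebra.ι k (π p) := rfl
  have key : μ ∘ₗ f = (3 : k) • (⋀[k]^3 Q).subtype := by
    refine LinearMap.ext_on span_ιMulti_three ?_
    rintro _ ⟨a, b, c, rfl⟩
    rw [LinearMap.comp_apply, hf, LinearMap.smul_apply, Submodule.subtype_apply,
      coe_ιMulti_three]
    simp only [map_add, map_sub, hμ, hπ', coe_ιMulti_two]
    have h₁ : ExteriorAlgebra.ι k b * ExteriorAlgebra.ι k c * ExteriorAlgebra.ι k a =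
        ExteriorAlgebra.ι k a * (ExteriorAlgebra.ι k b * ExteriorAlgebra.ι k c) := by
      rw [mul_assoc, ExteriorAlgebra.ι_mul_ι_swap c a, mul_neg, ← mul_assoc,
        ExteriorAlgebra.ι_mul_ι_swap b a, neg_mul, neg_neg, mul_assoc]
    have h₂ : ExteriorAlgebra.ι k a * ExteriorAlgebra.ι k c * ExteriorAlgebra.ι k b =
        - (ExteriorAlgebra.ι k a * (ExteriorAlgebra.ι k b * ExteriorAlgebra.ι k c)) := by
      rw [mul_assoc, ExteriorAlgebra.ι_mul_ι_swap c b, mul_neg]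
    rw [h₁, h₂, mul_assoc]
    module
  rw [injective_iff_map_eq_zero]
  intro x hx
  have h : (3 : k) • x = 0 := by
    have := LinearMap.congr_fun key x
    rw [LinearMap.comp_apply, hx, map_zero] at this
    exact Subtype.ext this.symm
  exact (smul_eq_zero.1 h).resolve_left (by norm_num)

/-- Exactness of the Koszul sequence in degree three over a domain of characteristic zero. -/
theorem koszul_exact_sequence [IsDomain k] [CharZero k] [Module.Free k Q] [Module.Finite k Q]
    [Module.Free k T] (α : Q →ₗ[k] P) (β : P →ₗ[k] T)
    (hα : Function.Injective α) (hβ : Function.Surjective β) (hαβ : Function.Exact α β)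
    (f₁ : ⋀[k]^3 Q →ₗ[k] (⋀[k]^2 Q) ⊗[k] P) (f₂ : (⋀[k]^2 Q) ⊗[k] P →ₗ[k] Q ⊗[k] Sym2M k P)
    (f₃ : Q ⊗[k] Sym2M k P →ₗ[k] Sym3M k P) (f₄ : Sym3M k P →ₗ[k] Sym3M k T)
    (hf₁ : ∀ a b c : Q, f₁ (ιMulti k 3 ![a, b, c]) = ιMulti k 2 ![b, c] ⊗ₜ[k] α a -
      ιMulti k 2 ![a, c] ⊗ₜ[k] α b + ιMulti k 2 ![a, b] ⊗ₜ[k] α c)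
    (hf₂ : ∀ (a b : Q) (p : P), f₂ (ιMulti k 2 ![a, b] ⊗ₜ[k] p) =
      a ⊗ₜ[k] symMk (α b) p - b ⊗ₜ[k] symMk (α a) p)
    (hf₃ : ∀ (a : Q) (p p' : P), f₃ (a ⊗ₜ[k] symMk p p') = sym3Mk (α a) p p')
    (hf₄ : ∀ p p' p'' : P, f₄ (sym3Mk p p' p'') = sym3Mk (β p) (β p') (β p'')) :
    Function.Injective f₁ ∧ Function.Exact f₁ f₂ ∧ Function.Exact f₂ f₃ ∧
      Function.Exact f₃ f₄ ∧ Function.Surjective f₄ := by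
  obtain ⟨σ, hσ⟩ := β.exists_rightInverse_of_surjective (LinearMap.range_eq_top.2 hβ)
  obtain ⟨e, he, -⟩ := hαβ.splitSurjectiveEquiv hα ⟨σ, hσ⟩
  let π : P →ₗ[k] Q := LinearMap.fst k Q T ∘ₗ e
  have hπ : π ∘ₗ α = .id := by ext q; simp [π, he]
  let b := Module.finBasis k Q
  let c := (b.prod (Module.Free.chooseBasis k T)).map e.symm
  exact ⟨koszul_injective α π hπ f₁ hf₁,
    koszul_exact_two b c wedgeHom ιMulti_two_self span_ιMulti_two
      (fun a b c ↦ ιMulti k 3 ![a, b, c]) span_ιMulti_three α (fun i ↦ by simp [c, he])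
      f₁ f₂ hf₁ hf₂,
    koszul_exact_one wedgeHom span_ιMulti_two α π hπ f₂ f₃ hf₂ hf₃,
    koszul_exact_zero α β hαβ σ hσ f₃ f₄ hf₃ hf₄,
    sym3M_map_surjective β hβ f₄ hf₄⟩

/-- The `k`-module structure of the symmetric square. Over `ℤ`, instance search finds
`AddCommGroup.toIntModule` instead. -/
abbrev sym2MModule (k V : Type*) [CommRing k] [AddCommGroup V] [Module k V] :
    Module k (Sym2M k V) := inferInstance

/-- The `k`-module structure of the symmetric cube. Over `ℤ`, instance search finds
`AddCommGroup.toIntModule` instead. -/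
abbrev sym3MModule (k V : Type*) [CommRing k] [AddCommGroup V] [Module k V] :
    Module k (Sym3M k V) := inferInstance

/-- The Koszul sequence over `ℤ`, for any choice of the (unique) `ℤ`-module structures. -/
theorem koszul_exact_sequence_int {Q P T : Type*}
    [AddCommGroup Q] [Module ℤ Q] [Module.Free ℤ Q] [Module.Finite ℤ Q]
    [AddCommGroup P] [Module ℤ P] [AddCommGroup T] [Module ℤ T] [Module.Free ℤ T]
    {m₂ : Module ℤ (⋀[ℤ]^2 Q)} {m₃ : Module ℤ (⋀[ℤ]^3 Q)} {n₂ : Module ℤ (Sym2M ℤ P)}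
    {n₃ : Module ℤ (Sym3M ℤ P)} {n₃' : Module ℤ (Sym3M ℤ T)}
    {l₁ : Module ℤ ((⋀[ℤ]^2 Q) ⊗[ℤ] P)} {l₂ : Module ℤ (Q ⊗[ℤ] Sym2M ℤ P)}
    (α : Q →ₗ[ℤ] P) (β : P →ₗ[ℤ] T)
    (hα : Function.Injective α) (hβ : Function.Surjective β)
    (hαβ : Function.Exact α β)
    (f₁ : ⋀[ℤ]^3 Q →ₗ[ℤ] (⋀[ℤ]^2 Q) ⊗[ℤ] P)
    (f₂ : (⋀[ℤ]^2 Q) ⊗[ℤ] P →ₗ[ℤ] Q ⊗[ℤ] Sym2M ℤ P)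
    (f₃ : Q ⊗[ℤ] Sym2M ℤ P →ₗ[ℤ] Sym3M ℤ P)
    (f₄ : Sym3M ℤ P →ₗ[ℤ] Sym3M ℤ T)
    (hf₁ : ∀ a b c : Q, f₁ (wedge3 a b c) =
      wedge2 b c ⊗ₜ[ℤ] α a - wedge2 a c ⊗ₜ[ℤ] α b + wedge2 a b ⊗ₜ[ℤ] α c)
    (hf₂ : ∀ (a b : Q) (p : P), f₂ (wedge2 a b ⊗ₜ[ℤ] p) =
      a ⊗ₜ[ℤ] symMk (α b) p - b ⊗ₜ[ℤ] symMk (α a) p)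
    (hf₃ : ∀ (a : Q) (p p' : P), f₃ (a ⊗ₜ[ℤ] symMk p p') = sym3Mk (α a) p p')
    (hf₄ : ∀ p p' p'' : P, f₄ (sym3Mk p p' p'') = sym3Mk (β p) (β p') (β p'')) :
    Function.Injective f₁ ∧ Function.Exact f₁ f₂ ∧ Function.Exact f₂ f₃ ∧
      Function.Exact f₃ f₄ ∧ Function.Surjective f₄ := by
  obtain rfl : l₁ = TensorProduct.instModule := Subsingleton.elim _ _
  obtain rfl : l₂ = TensorProduct.instModule := Subsingleton.elim _ _
  obtain rfl : m₂ = (⋀[ℤ]^2 Q).module := Subsingleton.elim _ _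
  obtain rfl : m₃ = (⋀[ℤ]^3 Q).module := Subsingleton.elim _ _
  obtain rfl : n₂ = sym2MModule ℤ P := Subsingleton.elim _ _
  obtain rfl : n₃ = sym3MModule ℤ P := Subsingleton.elim _ _
  obtain rfl : n₃' = sym3MModule ℤ T := Subsingleton.elim _ _
  exact koszul_exact_sequence α β hα hβ hαβ f₁ f₂ f₃ f₄ hf₁ hf₂ hf₃ hf₄

end ExteriorPowers

/-- **Statement 11.** Let `0 → Q --α--> P --β--> T → 0` be a short exact sequence of finitely
generated free abelian groups.  Then the sequence
`0 → Λ³Q → Λ²Q ⊗ P → Q ⊗ S²(P) → S³(P) → S³(T) → 0` is exact, where the maps are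
`a∧b∧c ↦ (b∧c)⊗α(a) − (a∧c)⊗α(b) + (a∧b)⊗α(c)`;
`(a∧b)⊗p ↦ a⊗(α(b)·p) − b⊗(α(a)·p)`; `a⊗s ↦ α(a)·s`; and the map `S³(β)` induced by `β`. -/
theorem statement11 {Q P T : Type*}
    [AddCommGroup Q] [Module ℤ Q] [Module.Free ℤ Q] [Module.Finite ℤ Q]
    [AddCommGroup P] [Module ℤ P] [Module.Free ℤ P] [Module.Finite ℤ P]
    [AddCommGroup T] [Module ℤ T] [Module.Free ℤ T] [Module.Finite ℤ T]
    (α : Q →ₗ[ℤ] P) (β : P →ₗ[ℤ] T)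
    (hα : Function.Injective α) (hβ : Function.Surjective β)
    (hαβ : Function.Exact α β)
    (f₁ : ⋀[ℤ]^3 Q →ₗ[ℤ] (⋀[ℤ]^2 Q) ⊗[ℤ] P)
    (f₂ : (⋀[ℤ]^2 Q) ⊗[ℤ] P →ₗ[ℤ] Q ⊗[ℤ] Sym2M ℤ P)
    (f₃ : Q ⊗[ℤ] Sym2M ℤ P →ₗ[ℤ] Sym3M ℤ P)
    (f₄ : Sym3M ℤ P →ₗ[ℤ] Sym3M ℤ T)
    (hf₁ : ∀ a b c : Q, f₁ (wedge3 a b c) =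
      wedge2 b c ⊗ₜ[ℤ] α a - wedge2 a c ⊗ₜ[ℤ] α b + wedge2 a b ⊗ₜ[ℤ] α c)
    (hf₂ : ∀ (a b : Q) (p : P), f₂ (wedge2 a b ⊗ₜ[ℤ] p) =
      a ⊗ₜ[ℤ] symMk (α b) p - b ⊗ₜ[ℤ] symMk (α a) p)
    (hf₃ : ∀ (a : Q) (p p' : P), f₃ (a ⊗ₜ[ℤ] symMk p p') = sym3Mk (α a) p p')
    (hf₄ : ∀ p p' p'' : P, f₄ (sym3Mk p p' p'') = sym3Mk (β p) (β p') (β p'')) :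
    Function.Injective f₁ ∧ Function.Exact f₁ f₂ ∧ Function.Exact f₂ f₃ ∧
      Function.Exact f₃ f₄ ∧ Function.Surjective f₄ := by
  exact koszul_exact_sequence_int α β hα hβ hαβ f₁ f₂ f₃ f₄ hf₁ hf₂ hf₃ hf₄

end
end

section
/- Let G be a finite group of odd order and let 0 → ℤⁿ → P → T → 0 be a short exact sequence of G-modules that are finitely generated free as abelian groups, where ℤⁿ carries the trivial G-action and P is a finitely generated free ℤ[G]-module. Then for every G-module A and every i ≥ 1 there is an isomorphism Hⁱ(G, S²(T) ⊗ℤ A) ≅ H^{i+2}(G, A)^{⊕ n(n−1)/2}, where G acts diagonally on S²(T) ⊗ℤ A. -/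
noncomputable section

open QuaternionGroup Finsupp TensorProduct

/-- If a set is mapped into its span by `f`, then the span is `f`-stable. -/
theorem Submodule.span_stable {k V : Type*} [CommRing k] [AddCommGroup V] [Module k V]
    {f : V →ₗ[k] V} {s : Set V} (h : ∀ x ∈ s, f x ∈ Submodule.span k s) :
    ∀ v ∈ Submodule.span k s, f v ∈ Submodule.span k s := by
  intro v hv
  have h2 : (Submodule.span k s).map f ≤ Submodule.span k s := by
    rw [Submodule.map_span, Submodule.span_le]
    rintro _ ⟨x, hx, rfl⟩
    exact h x hx
  exact h2 ⟨v, hv, rfl⟩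

/-- The representation induced on the quotient by a stable submodule. -/
def Representation.quot {k G V : Type*} [CommRing k] [Monoid G] [AddCommGroup V] [Module k V]
    (ρ : Representation k G V) (W : Submodule k V) (h : ∀ g, ∀ v ∈ W, ρ g v ∈ W) :
    Representation k G (V ⧸ W) where
  toFun g := W.mapQ W (ρ g) (fun v hv => h g v hv)
  map_one' := by
    refine Submodule.linearMap_qext _ ?_
    ext v
    simp
  map_mul' g₁ g₂ := by
    refine Submodule.linearMap_qext _ ?_
    ext v
    simp [Submodule.mapQ_apply]

/-- The representation induced on a stable submodule. -/
def Representation.subrep {k G V : Type*} [CommRing k] [Monoid G] [AddCommGroup V] [Module k V]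
    (ρ : Representation k G V) (W : Submodule k V) (h : ∀ g, ∀ v ∈ W, ρ g v ∈ W) :
    Representation k G W where
  toFun g := (ρ g).restrict (fun v hv => h g v hv)
  map_one' := by
    ext v
    simp [LinearMap.restrict_apply]
  map_mul' g₁ g₂ := by
    ext v
    simp [LinearMap.restrict_apply]

section Sym2

variable (k : Type*) [CommRing k] (V : Type*) [AddCommGroup V] [Module k V]

variable {k V}

theorem symSub_stable {G : Type*} [Monoid G] (ρ : Representation k G V) :
    ∀ g, ∀ w ∈ symSub k V, (ρ.tprod ρ) g w ∈ symSub k V := by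
  intro g
  refine Submodule.span_stable ?_
  rintro _ ⟨u, v, rfl⟩
  rw [map_sub]
  exact Submodule.subset_span ⟨ρ g u, ρ g v, by simp [Representation.tprod_apply]⟩

/-- The induced representation on the symmetric square. -/
def sym2Rep {G : Type*} [Monoid G] (ρ : Representation k G V) :
    Representation k G (Sym2M k V) :=
  (ρ.tprod ρ).quot (symSub k V) (symSub_stable ρ)

end Sym2

namespace Representation

section RelProjective

variable {k G V W : Type*} [CommRing k] [Group G] [Fintype G] [AddCommGroup V] [Module k V]
  [AddCommGroup W] [Module k W]

/-- A representation of a finite group is relatively projective (with respect to the trivial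
subgroup) if the identity is the trace of some linear endomorphism. -/
def IsRelProjective (ρ : Representation k G V) : Prop :=
  ∃ p : V →ₗ[k] V, ∀ v, ∑ g, ρ g (p (ρ g⁻¹ v)) = v

theorem IsRelProjective.tprod {ρ : Representation k G V} (h : ρ.IsRelProjective)
    (σ : Representation k G W) : (ρ.tprod σ).IsRelProjective := by
  obtain ⟨p, hp⟩ := h
  refine ⟨p.rTensor W, fun x ↦ ?_⟩
  induction x using TensorProduct.induction_on with
  | zero => simp
  | tmul v w =>
    have (g : G) : (ρ.tprod σ) g (p.rTensor W ((ρ.tprod σ) g⁻¹ (v ⊗ₜ w))) =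
        ρ g (p (ρ g⁻¹ v)) ⊗ₜ[k] w := by simp
    simp_rw [this, ← TensorProduct.sum_tmul, hp]
  | add x y hx hy => simp only [map_add, Finset.sum_add_distrib, hx, hy]

/-- The pointwise representation on a space of functions. -/
def compLeft (ρ : Representation k G V) (ι : Type*) : Representation k G (ι → V) where
  toFun g := (ρ g).compLeft ι
  map_one' := by ext; simp
  map_mul' _ _ := by ext; simp

omit [Fintype G] in
@[simp]
theorem compLeft_apply (ρ : Representation k G V) (ι : Type*) (g : G) (x : ι → V) (i : ι) :
    ρ.compLeft ι g x i = ρ g (x i) := rfl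

theorem IsRelProjective.compLeft {ρ : Representation k G V} (h : ρ.IsRelProjective)
    (ι : Type*) : (ρ.compLeft ι).IsRelProjective := by
  obtain ⟨p, hp⟩ := h
  refine ⟨p.compLeft ι, fun x ↦ funext fun i ↦ ?_⟩
  simpa using hp (x i)

theorem isRelProjective_of_free (ρ : Representation k G V)
    [Module.Free (MonoidAlgebra k G) ρ.asModule] : ρ.IsRelProjective := by
  classical
  let b := Module.Free.chooseBasis (MonoidAlgebra k G) ρ.asModule
  let c := ((MonoidAlgebra.basis G k).smulTower b).map ρ.asModuleEquiv
  have hc (g h : G) (i) : ρ g (c (h, i)) = c (g * h, i) := by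
    simp [c, Module.Basis.smulTower_apply]
    rfl
  let p : V →ₗ[k] V := c.constr k fun x ↦ if x.1 = 1 then c x else 0
  have hp : ∑ g, ρ g ∘ₗ p ∘ₗ ρ g⁻¹ = LinearMap.id := by
    refine c.ext fun ⟨h, i⟩ ↦ ?_
    have (g : G) : ρ g (p (ρ g⁻¹ (c (h, i)))) = if g = h then c (h, i) else 0 := by
      rw [hc, Module.Basis.constr_basis]
      by_cases hg : g = h <;> simp [hg, hc, inv_mul_eq_one]
    simp [LinearMap.sum_apply, this]
  exact ⟨p, fun v ↦ by simpa [LinearMap.sum_apply] using congr($hp v)⟩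

end RelProjective

end Representation

namespace groupCohomology

open CategoryTheory Limits

universe u

variable {k G : Type u} [CommRing k] [Group G]

theorem isZero_of_isRelProjective [Fintype G] {V : Type u} [AddCommGroup V] [Module k V]
    {ρ : Representation k G V} (h : ρ.IsRelProjective) (n : ℕ) :
    IsZero (groupCohomology (Rep.of ρ) (n + 1)) := by
  obtain ⟨p, hp⟩ := h
  let S : Subgroup G := ⊥
  let X : Rep k S := Rep.of (ρ.comp S.subtype)
  have hX : IsZero ((functor k G (n + 1)).obj (Rep.coind S.subtype X)) :=
    (isZero_groupCohomology_succ_of_subsingleton X n).of_iso (coindIso X (n + 1))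
  let f : Rep.of ρ ⟶ Rep.coind S.subtype X := Rep.ofHom
    (LinearMap.intertwiningMap_of_isIntertwiningMap _ _
      (LinearMap.codRestrict _ (LinearMap.pi fun g ↦ p ∘ₗ ρ g) (by
        rintro v ⟨g, rfl : g = 1⟩ h
        simp [X])) (by
        intro g v
        ext h
        change p (ρ h (ρ g v)) = p (ρ (h * g) v)
        simp))
  let q : Rep.coind S.subtype X ⟶ Rep.of ρ := Rep.ofHom
    (LinearMap.intertwiningMap_of_isIntertwiningMap _ _
      ((∑ g : G, ρ g⁻¹ ∘ₗ LinearMap.proj g) ∘ₗ Submodule.subtype _) (by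
        intro g v
        change (∑ h : G, ρ h⁻¹ ∘ₗ LinearMap.proj h) (fun h ↦ v.1 (h * g)) =
          ρ g ((∑ h : G, ρ h⁻¹ ∘ₗ LinearMap.proj h) v.1)
        simp only [LinearMap.sum_apply, LinearMap.comp_apply, LinearMap.proj_apply, map_sum]
        refine Fintype.sum_equiv (Equiv.mulRight g) _ _ fun h ↦ ?_
        simp [← Module.End.mul_apply, ← map_mul]))
  have hfq : f ≫ q = 𝟙 _ := by
    ext v
    change (∑ h : G, ρ h⁻¹ ∘ₗ LinearMap.proj h) (fun h ↦ p (ρ h v)) = v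
    simp only [LinearMap.sum_apply, LinearMap.comp_apply, LinearMap.proj_apply]
    rw [← Equiv.sum_comp (Equiv.inv G)]
    simpa using hp v
  have := congrArg (functor k G (n + 1)).map hfq
  rw [CategoryTheory.Functor.map_comp, CategoryTheory.Functor.map_id] at this
  refine (IsZero.iff_id_eq_zero _).2 (this.symm.trans ?_)
  rw [hX.eq_of_tgt ((functor k G (n + 1)).map f) 0, zero_comp]
  rfl

theorem shortExact_of {U V W : Type u} [AddCommGroup U] [Module k U] [AddCommGroup V] [Module k V]
    [AddCommGroup W] [Module k W] {ρ : Representation k G U} {σ : Representation k G V}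
    {τ : Representation k G W} (f : ρ.IntertwiningMap σ) (g : σ.IntertwiningMap τ)
    (hf : Function.Injective f) (hg : Function.Surjective g) (hfg : Function.Exact f g) :
    (ShortComplex.mk (Rep.ofHom f) (Rep.ofHom g)
      (Rep.hom_ext <| DFunLike.ext _ _ hfg.apply_apply_eq_zero)).ShortExact where
  exact := by
    rw [← ShortComplex.exact_map_iff_of_faithful _ (forget₂ (Rep k G) (ModuleCat k))]
    exact (ShortComplex.ShortExact.moduleCat_exact_iff_function_exact _).2 hfg
  mono_f := (Rep.mono_iff_injective _).2 hf
  epi_g := (Rep.epi_iff_surjective _).2 hg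

theorem nonempty_iso_succ [Fintype G] {U V W : Type u} [AddCommGroup U] [Module k U]
    [AddCommGroup V] [Module k V] [AddCommGroup W] [Module k W] {ρ : Representation k G U}
    {σ : Representation k G V} {τ : Representation k G W} (f : ρ.IntertwiningMap σ)
    (g : σ.IntertwiningMap τ) (hf : Function.Injective f) (hg : Function.Surjective g)
    (hfg : Function.Exact f g) (hσ : σ.IsRelProjective) {i : ℕ} (hi : 1 ≤ i) :
    Nonempty (groupCohomology (Rep.of τ) i ≅ groupCohomology (Rep.of ρ) (i + 1)) := by
  obtain ⟨i, rfl⟩ := Nat.exists_eq_add_of_le' hi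
  have := isIso_δ_of_isZero (shortExact_of f g hf hg hfg) (i + 1)
    (isZero_of_isRelProjective hσ i) (isZero_of_isRelProjective hσ (i + 1))
  exact ⟨asIso (δ (shortExact_of f g hf hg hfg) (i + 1) (i + 2) rfl)⟩

/-- Dimension shifting along a four-term exact sequence. -/
theorem nonempty_iso_add_two [Fintype G] {V₁ V₂ V₃ V₄ : Type u} [AddCommGroup V₁] [Module k V₁]
    [AddCommGroup V₂] [Module k V₂] [AddCommGroup V₃] [Module k V₃] [AddCommGroup V₄] [Module k V₄]
    {ρ₁ : Representation k G V₁} {ρ₂ : Representation k G V₂} {ρ₃ : Representation k G V₃}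
    {ρ₄ : Representation k G V₄} (f₁ : ρ₁.IntertwiningMap ρ₂) (f₂ : ρ₂.IntertwiningMap ρ₃)
    (f₃ : ρ₃.IntertwiningMap ρ₄) (h₁ : Function.Injective f₁) (h₁₂ : Function.Exact f₁ f₂)
    (h₂₃ : Function.Exact f₂ f₃) (h₃ : Function.Surjective f₃) (hρ₂ : ρ₂.IsRelProjective)
    (hρ₃ : ρ₃.IsRelProjective) {i : ℕ} (hi : 1 ≤ i) :
    Nonempty (groupCohomology (Rep.of ρ₄) i ≅ groupCohomology (Rep.of ρ₁) (i + 2)) := by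
  let K := LinearMap.ker f₃.toLinearMap
  let κ : Representation k G K := Representation.subrep ρ₃ K fun g v (hv : f₃ v = 0) ↦ by
    change f₃ _ = 0
    rw [f₃.isIntertwining, hv, map_zero]
  let ι : κ.IntertwiningMap ρ₃ :=
    LinearMap.intertwiningMap_of_isIntertwiningMap _ _ K.subtype fun _ _ ↦ rfl
  let π : ρ₂.IntertwiningMap κ :=
    LinearMap.intertwiningMap_of_isIntertwiningMap _ _
      (f₂.toLinearMap.codRestrict K fun v ↦ h₂₃.apply_apply_eq_zero v)
      fun g v ↦ Subtype.ext (f₂.isIntertwining _ _ g v)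
  obtain ⟨e⟩ := nonempty_iso_succ ι f₃ Subtype.val_injective h₃
    (fun v ↦ ⟨fun hv ↦ ⟨⟨v, hv⟩, rfl⟩, by rintro ⟨w, rfl⟩; exact w.2⟩) hρ₃ hi
  obtain ⟨e'⟩ := nonempty_iso_succ f₁ π h₁
    (by
      rintro ⟨v, hv⟩
      obtain ⟨w, rfl⟩ := (h₂₃ v).1 hv
      exact ⟨w, rfl⟩)
    (fun v ↦ Subtype.ext_iff.trans (h₁₂ v)) hρ₂ (Nat.le_succ_of_le hi)
  exact ⟨e ≪≫ e'⟩

/-- A biproduct decomposition into copies of a single module. -/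
def linearEquivPi {J : Type*} [Fintype J] [DecidableEq J] {X Y : ModuleCat k}
    (p : J → (X ⟶ Y)) (s : J → (Y ⟶ X)) (hsp : ∀ i j, s i ≫ p j = if i = j then 𝟙 Y else 0)
    (hps : ∑ j, p j ≫ s j = 𝟙 X) : X ≃ₗ[k] (J → Y) :=
  .ofLinearMap (LinearMap.pi fun j ↦ (p j).hom) (∑ j, (s j).hom ∘ₗ LinearMap.proj j)
    (LinearMap.ext fun x ↦ funext fun j ↦ by
      have h (i : J) : (p j).hom ((s i).hom (x i)) = if i = j then x i else 0 := by
        change (s i ≫ p j).hom (x i) = _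
        rw [hsp]
        split_ifs <;> rfl
      simp [h])
    (LinearMap.ext fun x ↦ by
      have h := congr(ModuleCat.Hom.hom $hps x)
      rw [ModuleCat.hom_sum, LinearMap.sum_apply] at h
      simpa [LinearMap.sum_apply] using h)

/-- Group cohomology commutes with finite direct sums of copies of a representation. -/
theorem nonempty_linearEquiv_pi {J : Type} [Fintype J] [DecidableEq J] {A : Type u}
    [AddCommGroup A] [Module k A] (ρ : Representation k G A) (n : ℕ) :
    Nonempty (groupCohomology (Rep.of ((Representation.trivial k G (J → k)).tprod ρ)) n ≃ₗ[k]
      (J → groupCohomology (Rep.of ρ) n)) := by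
  let X := Rep.of ((Representation.trivial k G (J → k)).tprod ρ)
  let p (j : J) : X ⟶ Rep.of ρ := Rep.ofHom
    (LinearMap.intertwiningMap_of_isIntertwiningMap _ _
      (TensorProduct.lid k A ∘ₗ (LinearMap.proj j : (J → k) →ₗ[k] k).rTensor A) (by
        intro g v
        induction v using TensorProduct.induction_on with
        | zero => simp
        | tmul x y => simp
        | add x y hx hy => simp only [map_add, hx, hy]))
  let s (j : J) : Rep.of ρ ⟶ X := Rep.ofHom
    (LinearMap.intertwiningMap_of_isIntertwiningMap _ _
      (TensorProduct.mk k (J → k) A (Pi.single j 1)) (by simp))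
  have hsp (i j : J) : s i ≫ p j = if i = j then 𝟙 _ else 0 := by
    ext a
    change (Pi.single i 1 : J → k) j • a = _
    split_ifs with h
    · subst h; simp
    · simp [Pi.single_eq_of_ne' h]
  have hps : ∑ j, p j ≫ s j = 𝟙 X := by
    have (v : (J → k) ⊗[k] A) : ∑ j, (s j).hom ((p j).hom v) = v := by
      induction v using TensorProduct.induction_on with
      | zero => simp
      | tmul x a =>
        change ∑ j, Pi.single j 1 ⊗ₜ[k] (x j • a) = x ⊗ₜ a
        simp_rw [← TensorProduct.smul_tmul, ← TensorProduct.sum_tmul]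
        congr 1
        exact (pi_eq_sum_univ' x).symm
      | add x y hx hy => simp only [map_add, Finset.sum_add_distrib, hx, hy]
    refine (forget₂ (Rep k G) (ModuleCat k)).map_injective ?_
    rw [CategoryTheory.Functor.map_sum]
    ext v
    rw [ModuleCat.hom_sum, LinearMap.sum_apply]
    exact this v
  let F := functor k G n
  have : F.Additive := ⟨fun {X Y f g} ↦ by
    change HomologicalComplex.homologyMap ((cochainsFunctor k G).map (f + g)) n = _
    rw [CategoryTheory.Functor.map_add, HomologicalComplex.homologyMap_add]
    rfl⟩
  refine ⟨linearEquivPi (X := F.obj X) (Y := F.obj (Rep.of ρ)) (fun j ↦ F.map (p j))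
    (fun j ↦ F.map (s j)) (fun i j ↦ ?_) ?_⟩
  · rw [← F.map_comp, hsp]
    split_ifs <;> simp
  · simpa using congrArg F.map hps

end groupCohomology

section SymmetricSquare

variable {k V W M : Type*} [CommRing k] [AddCommGroup V] [Module k V] [AddCommGroup W] [Module k W]
  [AddCommGroup M] [Module k M]

/-- The product in the symmetric square as a bilinear map. -/
def symMkₗ : V →ₗ[k] V →ₗ[k] Sym2M k V := (TensorProduct.mk k V V).compr₂ (symSub k V).mkQ

theorem symMkₗ_comm (u v : V) : symMkₗ (k := k) u v = symMkₗ v u :=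
  (Submodule.Quotient.eq _).2 (Submodule.subset_span ⟨u, v, rfl⟩)

theorem symHom_ext {f g : Sym2M k V →ₗ[k] M} (h : ∀ u v, f (symMkₗ u v) = g (symMkₗ u v)) :
    f = g :=
  Submodule.linearMap_qext _ (TensorProduct.ext' h)

/-- The linear map out of the symmetric square induced by a symmetric bilinear map. -/
def symLift (B : V →ₗ[k] V →ₗ[k] M) (hB : ∀ u v, B u v = B v u) : Sym2M k V →ₗ[k] M :=
  (symSub k V).liftQ (TensorProduct.lift B) <| Submodule.span_le.2 <| by
    rintro _ ⟨u, v, rfl⟩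
    simp [hB u v]

@[simp]
theorem symLift_symMkₗ (B : V →ₗ[k] V →ₗ[k] M) (hB : ∀ u v, B u v = B v u) (u v : V) :
    symLift B hB (symMkₗ u v) = B u v := rfl

/-- Functoriality of the symmetric square. -/
def symMap (f : V →ₗ[k] W) : Sym2M k V →ₗ[k] Sym2M k W :=
  symLift (symMkₗ.compl₁₂ f f) fun _ _ ↦ symMkₗ_comm _ _

@[simp]
theorem symMap_symMkₗ (f : V →ₗ[k] W) (u v : V) :
    symMap f (symMkₗ u v) = symMkₗ (k := k) (f u) (f v) := rfl

@[simp]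
theorem sym2Rep_symMkₗ {G : Type*} [Monoid G] (ρ : Representation k G V) (g : G) (u v : V) :
    sym2Rep ρ g (symMkₗ u v) = symMkₗ (k := k) (ρ g u) (ρ g v) := rfl

/-- In a finite group of odd order, one can choose one element from each pair `{g, g⁻¹}` with
`g ≠ 1`. -/
theorem exists_finset_disjoint_inv {G : Type*} [Group G] [Fintype G] [DecidableEq G]
    (hodd : Odd (Fintype.card G)) :
    ∃ s : Finset G, 1 ∉ s ∧ ∀ g, g ≠ 1 → (g ∈ s ↔ g⁻¹ ∉ s) := by
  obtain ⟨f⟩ := Fintype.truncEquivFin G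
  refine ⟨Finset.univ.filter fun g ↦ f g < f g⁻¹, by simp, fun g hg ↦ ?_⟩
  have : f g ≠ f g⁻¹ := by
    intro h
    have h2 : g ^ 2 = 1 := by
      rw [sq]
      nth_rewrite 2 [f.injective h]
      simp
    have := Nat.Coprime.eq_one_of_dvd
      ((Nat.coprime_two_right.2 hodd).coprime_dvd_left (orderOf_dvd_card (x := g)))
      (orderOf_dvd_of_pow_eq_one h2)
    exact hg (orderOf_eq_one_iff.1 this)
  simp only [Finset.mem_filter, Finset.mem_univ, true_and, inv_inv, not_lt]
  exact ⟨le_of_lt, fun h ↦ lt_of_le_of_ne h this⟩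

theorem sum_add_sum_inv {G : Type*} [Group G] [Fintype G] [DecidableEq G] {s : Finset G}
    (h1 : 1 ∉ s) (hs : ∀ g, g ≠ 1 → (g ∈ s ↔ g⁻¹ ∉ s)) (f : G → M) :
    f 1 + ∑ g ∈ s, (f g + f g⁻¹) = ∑ g, f g := by
  have hinv : ∑ g ∈ s, f g⁻¹ = ∑ g ∈ s.map (Equiv.inv G).toEmbedding, f g := by simp
  rw [← Finset.add_sum_erase _ _ (Finset.mem_univ 1), Finset.sum_add_distrib, hinv,
    ← Finset.sum_union]
  · congr 2
    ext g
    by_cases hg : g = 1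
    · simp [hg, h1]
    · simp [hg, hs g hg, em']
  · refine Finset.disjoint_left.2 fun g hg hg' ↦ ?_
    have : g ≠ 1 := fun h ↦ h1 (h ▸ hg)
    exact (hs g this).1 hg (by simpa using hg')

namespace Representation

theorem IsRelProjective.sym2Rep {G : Type*} [Group G] [Fintype G] {ρ : Representation k G V}
    (h : ρ.IsRelProjective) (hodd : Odd (Fintype.card G)) : (sym2Rep ρ).IsRelProjective := by
  classical
  obtain ⟨p, hp⟩ := h
  obtain ⟨s, h1, hs⟩ := exists_finset_disjoint_inv hodd
  let e (g : G) : V →ₗ[k] V := ρ g ∘ₗ p ∘ₗ ρ g⁻¹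
  have he (v : V) : ∑ g, e g v = v := hp v
  have hρe (g h : G) (v : V) : ρ g (e h (ρ g⁻¹ v)) = e (g * h) v := by
    simp [e]
  let B : V →ₗ[k] V →ₗ[k] Sym2M k V := symMkₗ.compl₁₂ (e 1) (e 1) +
    ∑ h ∈ s, (symMkₗ.compl₁₂ (e 1) (e h) + symMkₗ.compl₁₂ (e h) (e 1))
  have hB (u v : V) : B u v = B v u := by
    simp only [B, LinearMap.add_apply, LinearMap.sum_apply, LinearMap.compl₁₂_apply]
    congr 1
    · exact symMkₗ_comm _ _
    · refine Finset.sum_congr rfl fun h _ ↦ ?_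
      rw [add_comm, symMkₗ_comm, symMkₗ_comm (e 1 u)]
  have key : ∑ g, _root_.sym2Rep ρ g ∘ₗ symLift B hB ∘ₗ _root_.sym2Rep ρ g⁻¹ = LinearMap.id := by
    refine symHom_ext fun u v ↦ ?_
    have (g : G) : _root_.sym2Rep ρ g (symLift B hB (_root_.sym2Rep ρ g⁻¹ (symMkₗ u v))) =
        symMkₗ (e g u) (e g v) +
          ∑ h ∈ s, (symMkₗ (e g u) (e (g * h) v) + symMkₗ (e (g * h) u) (e g v)) := by
      simp [B, LinearMap.sum_apply, hρe]
    simp only [LinearMap.sum_apply, LinearMap.comp_apply, this, LinearMap.id_apply]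
    calc
      _ = ∑ g, ∑ h, symMkₗ (k := k) (e g u) (e (g * h) v) := by
        have (g : G) := (sum_add_sum_inv h1 hs fun h ↦ symMkₗ (k := k) (e g u) (e (g * h) v)).symm
        simp only [this, Finset.sum_add_distrib, mul_one]
        refine congrArg _ (congrArg _ ?_)
        rw [Finset.sum_comm, Finset.sum_comm (t := s)]
        refine Finset.sum_congr rfl fun h _ ↦ ?_
        refine Fintype.sum_equiv (Equiv.mulRight h) _ _ fun g ↦ ?_
        simp
      _ = symMkₗ (∑ g, e g u) v := by
        rw [map_sum, LinearMap.sum_apply]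
        refine Finset.sum_congr rfl fun g _ ↦ ?_
        rw [← map_sum]
        exact congrArg _ ((Equiv.sum_comp (Equiv.mulLeft g) (e · v)).trans (he v))
      _ = symMkₗ u v := by rw [he]
  exact ⟨symLift B hB, fun x ↦ by simpa [LinearMap.sum_apply] using congr($key x)⟩

end Representation

end SymmetricSquare

theorem Function.Exact.rTensor_of_homotopy {k U V W : Type*} [CommRing k] [AddCommGroup U]
    [Module k U] [AddCommGroup V] [Module k V] [AddCommGroup W] [Module k W] {f : U →ₗ[k] V}
    {g : V →ₗ[k] W} {h : V →ₗ[k] U} {h' : W →ₗ[k] V} (hgf : g ∘ₗ f = 0)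
    (hh : f ∘ₗ h + h' ∘ₗ g = LinearMap.id) (A : Type*) [AddCommGroup A] [Module k A] :
    Function.Exact (f.rTensor A) (g.rTensor A) := by
  intro v
  have hgf' := congr(LinearMap.rTensor A $hgf)
  have hh' := congr(LinearMap.rTensor A $hh v)
  simp only [LinearMap.rTensor_comp, LinearMap.rTensor_add, LinearMap.rTensor_zero,
    LinearMap.rTensor_id, LinearMap.add_apply, LinearMap.comp_apply, LinearMap.id_apply] at hgf' hh'
  refine ⟨fun hv ↦ ⟨h.rTensor A v, by simpa [hv] using hh'⟩, ?_⟩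
  rintro ⟨u, rfl⟩
  exact congr($hgf' u)

namespace SymKoszul

variable {k P T ι : Type*} [CommRing k] [AddCommGroup P] [Module k P] [AddCommGroup T] [Module k T]
  [Fintype ι] [LinearOrder ι] [LocallyFiniteOrderTop ι]

/-- The degree two differential `eᵢ ∧ eⱼ ↦ eᵢ ⊗ aⱼ - eⱼ ⊗ aᵢ` of the Koszul complex. -/
def d₂ (a : ι → P) : ((Σ i : ι, Finset.Ioi i) → k) →ₗ[k] ι → P :=
  ∑ p, (LinearMap.proj p).smulRight (Pi.single p.1 (a p.2) - Pi.single (p.2 : ι) (a p.1))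

/-- The degree one differential `eᵢ ⊗ v ↦ aᵢ · v` of the Koszul complex. -/
def d₁ (a : ι → P) : (ι → P) →ₗ[k] Sym2M k P := ∑ i, symMkₗ (a i) ∘ₗ LinearMap.proj i

/-- The degree two part of the contracting homotopy. -/
def h₂ (r : ι → P →ₗ[k] k) : (ι → P) →ₗ[k] (Σ i : ι, Finset.Ioi i) → k :=
  LinearMap.pi fun p ↦ r p.2 ∘ₗ LinearMap.proj p.1

/-- The projection killing the components along `aⱼ` for `j > i`. -/
def tail (a : ι → P) (r : ι → P →ₗ[k] k) (i : ι) : P →ₗ[k] P :=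
  LinearMap.id - ∑ j ∈ Finset.Ioi i, (r j).smulRight (a j)

/-- The degree one part of the contracting homotopy. -/
def h₁ (a : ι → P) (r : ι → P →ₗ[k] k) : Sym2M k P →ₗ[k] ι → P :=
  LinearMap.pi fun i ↦ symLift
    (LinearMap.mk₂ k (fun u v ↦ r i u • tail a r i v + r i v • tail a r i u - (r i u * r i v) • a i)
      (fun _ _ _ ↦ by simp only [map_add]; module)
      (fun _ _ _ ↦ by simp only [map_smul, smul_eq_mul]; module)
      (fun _ _ _ ↦ by simp only [map_add]; module)
      (fun _ _ _ ↦ by simp only [map_smul, smul_eq_mul]; module))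
    (fun u v ↦ by simp only [LinearMap.mk₂_apply]; module)

variable {a : ι → P} {r : ι → P →ₗ[k] k}

omit [LinearOrder ι] [LocallyFiniteOrderTop ι] in
theorem d₁_apply (x : ι → P) : d₁ (k := k) a x = ∑ i, symMkₗ (a i) (x i) := by
  simp [d₁, LinearMap.sum_apply]

theorem d₂_apply (x : (Σ i : ι, Finset.Ioi i) → k) : d₂ a x =
    ∑ p, x p • (Pi.single p.1 (a p.2) - Pi.single (p.2 : ι) (a p.1)) := by
  simp [d₂, LinearMap.sum_apply]

omit [Fintype ι] in
theorem h₁_symMkₗ (u v : P) (i : ι) : h₁ a r (symMkₗ u v) i =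
    r i u • tail a r i v + r i v • tail a r i u - (r i u * r i v) • a i := rfl

omit [Fintype ι] in
theorem tail_apply (i : ι) (v : P) : tail a r i v = v - ∑ j ∈ Finset.Ioi i, r j v • a j := by
  simp [tail, LinearMap.sum_apply]

omit [LocallyFiniteOrderTop ι] in
theorem d₁_single (i : ι) (v : P) : d₁ (k := k) a (Pi.single i v) = symMkₗ (a i) v := by
  rw [d₁_apply, Finset.sum_eq_single i (fun j _ hj ↦ by simp [hj]) (by simp), Pi.single_eq_same]

theorem d₁_comp_d₂ : d₁ (k := k) a ∘ₗ d₂ a = 0 := by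
  refine LinearMap.ext fun x ↦ ?_
  simp [d₂_apply, d₁_single, symMkₗ_comm (a (Sigma.fst _))]

theorem h₂_comp_d₂ (hr : ∀ i j, r i (a j) = if i = j then 1 else 0) :
    h₂ r ∘ₗ d₂ a = LinearMap.id := by
  refine LinearMap.ext fun x ↦ funext fun q ↦ ?_
  have key (p : Σ i : ι, Finset.Ioi i) :
      r q.2 ((Pi.single p.1 (a p.2) - Pi.single (p.2 : ι) (a p.1) : ι → P) q.1) =
        if p = q then 1 else 0 := by
    obtain ⟨i, j, hij⟩ := p
    obtain ⟨i', j', hij'⟩ := q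
    rw [Finset.mem_Ioi] at hij hij'
    have h : Pi.single (M := fun _ ↦ P) j (a i) i' = 0 ∨ j' ≠ i := by
      by_cases h : j = i'
      · exact Or.inr fun h' ↦ by subst h h'; exact lt_asymm hij hij'
      · exact Or.inl (Pi.single_eq_of_ne' h _)
    have h' : r j' (Pi.single (M := fun _ ↦ P) j (a i) i') = 0 := by
      rcases h with h | h
      · simp [h]
      · by_cases hj : i' = j <;> simp [hj, hr, h]
    rw [Pi.sub_apply, map_sub, h', sub_zero]
    by_cases hi : i' = i
    · subst hi
      simp [hr, eq_comm]
    · simp [hi, Ne.symm hi]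
  simp only [LinearMap.comp_apply, d₂_apply, h₂, LinearMap.pi_apply, LinearMap.proj_apply, map_sum,
    map_smul, key]
  simp

theorem sum_sum_eq {M : Type*} [AddCommGroup M] (c : ι → ι → M) :
    ∑ i, ∑ j, c i j = ∑ i, (∑ j ∈ Finset.Ioi i, (c i j + c j i) + c i i) := by
  have h (i j : ι) : c i j = (if i < j then c i j else 0) + (if j < i then c i j else 0) +
      if i = j then c i j else 0 := by
    rcases lt_trichotomy i j with h | rfl | h
    · simp [h, h.not_gt, h.ne]
    · simp
    · simp [h, h.not_gt, h.ne']
  have h' (i : ι) (f : ι → M) : ∑ j ∈ Finset.Ioi i, f j = ∑ j, if i < j then f j else 0 := by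
    rw [← Finset.sum_filter]
    congr 1
    ext
    simp
  conv_lhs => enter [2, i, 2, j]; rw [h]
  simp only [Finset.sum_add_distrib]
  simp only [h', Finset.sum_ite_eq, Finset.mem_univ, if_true]
  rw [Finset.sum_comm (f := fun i j ↦ if j < i then c i j else 0)]

theorem d₁_comp_h₁ {σ : P →ₗ[k] P} (hσ : ∀ v, σ v = v - ∑ i, r i v • a i) :
    d₁ a ∘ₗ h₁ a r + symMap σ = LinearMap.id := by
  refine symHom_ext fun u v ↦ ?_
  let c (i j : ι) : Sym2M k P := (r i u * r j v) • symMkₗ (a i) (a j)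
  have h (i : ι) : symMkₗ (a i) (h₁ a r (symMkₗ u v) i) =
      r i u • symMkₗ (a i) v + r i v • symMkₗ (a i) u -
        (∑ j ∈ Finset.Ioi i, (c i j + c j i) + c i i) := by
    simp only [h₁_symMkₗ, tail_apply, map_sub, map_add, map_smul, map_sum, c,
      Finset.sum_add_distrib, smul_sub, Finset.smul_sum, smul_smul, symMkₗ_comm _ (a i),
      mul_comm (r _ u) (r i v)]
    abel
  have hxy : ∑ i, ∑ j, c i j = symMkₗ (∑ i, r i u • a i) (∑ i, r i v • a i) := by
    simp only [map_sum, LinearMap.sum_apply, map_smul, LinearMap.smul_apply,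
      Finset.smul_sum, smul_smul, c]
    rw [Finset.sum_comm]
    simp only [mul_comm]
  have hx (f : ι → k) (w : P) : ∑ i, f i • symMkₗ (k := k) (a i) w = symMkₗ (∑ i, f i • a i) w := by
    simp [LinearMap.sum_apply]
  simp only [LinearMap.add_apply, LinearMap.comp_apply, d₁_apply, h, symMap_symMkₗ, hσ,
    LinearMap.id_apply, Finset.sum_sub_distrib, ← sum_sum_eq, hxy]
  simp only [Finset.sum_add_distrib, hx, map_sub, LinearMap.sub_apply]
  rw [symMkₗ_comm u (∑ i, r i v • a i)]
  abel

theorem d₂_comp_h₂ (hr : ∀ i j, r i (a j) = if i = j then 1 else 0) :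
    d₂ a ∘ₗ h₂ r + h₁ a r ∘ₗ d₁ a = LinearMap.id := by
  refine LinearMap.pi_ext' fun i ↦ LinearMap.ext fun v ↦ funext fun l ↦ ?_
  have h : d₂ a (h₂ r (Pi.single i v)) l = ∑ j ∈ Finset.Ioi i,
      r j v • (Pi.single i (a j) - Pi.single j (a i) : ι → P) l := by
    rw [d₂_apply, Fintype.sum_sigma, Finset.sum_apply, Finset.sum_eq_single i]
    · simp [h₂, ← Finset.sum_coe_sort (Finset.Ioi i)]
    · intro j _ hj
      simp [h₂, hj]
    · simp
  simp only [LinearMap.add_apply, LinearMap.comp_apply, LinearMap.coe_single, d₁_single,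
    LinearMap.id_apply, Pi.add_apply, h, h₁_symMkₗ, tail_apply, hr]
  rcases lt_trichotomy l i with hl | rfl | hl
  · simp [Pi.single_apply, hl.ne, hl, hl.not_gt]
  · have (j : ι) (hj : j ∈ Finset.Ioi l) :
        r j v • (Pi.single l (a j) - Pi.single j (a l) : ι → P) l = r j v • a j := by
      simp [(Finset.mem_Ioi.1 hj).ne]
    rw [Finset.sum_congr rfl this]
    simp
  · simp [Pi.single_apply, hl.ne', hl, hl.not_gt]

end SymKoszul

section

open SymKoszul groupCohomology Representation

universe u

variable {k G P T A : Type u} [CommRing k] [Group G] [AddCommGroup P] [Module k P]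
  [AddCommGroup T] [Module k T] [AddCommGroup A] [Module k A]
  {ι : Type} [Fintype ι] [LinearOrder ι] [LocallyFiniteOrderTop ι]

namespace SymKoszul

variable (ρP : Representation k G P)

/-- `SymKoszul.d₂` as an intertwining map. -/
def d₂Hom {a : ι → P} (ha : ∀ g i, ρP g (a i) = a i) :
    (trivial k G ((Σ i : ι, Finset.Ioi i) → k)).IntertwiningMap (ρP.compLeft ι) :=
  LinearMap.intertwiningMap_of_isIntertwiningMap _ _ (d₂ a) fun g x ↦ funext fun l ↦ by
    have h (i j : ι) : ρP g (Pi.single (M := fun _ ↦ P) i (a j) l) =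
        Pi.single (M := fun _ ↦ P) i (a j) l := by
      by_cases hi : l = i
      · subst hi; simp [ha]
      · simp [hi]
    simp [d₂_apply, Finset.sum_apply, h]

/-- `SymKoszul.d₁` as an intertwining map. -/
def d₁Hom {a : ι → P} (ha : ∀ g i, ρP g (a i) = a i) :
    (ρP.compLeft ι).IntertwiningMap (sym2Rep ρP) :=
  LinearMap.intertwiningMap_of_isIntertwiningMap _ _ (d₁ a) fun g x ↦ by
    simp [d₁_apply, ha]

end SymKoszul

variable {ρP : Representation k G P} {ρT : Representation k G T}

/-- The symmetric square as an intertwining map. -/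
def symMapHom (β : ρP.IntertwiningMap ρT) : (sym2Rep ρP).IntertwiningMap (sym2Rep ρT) :=
  LinearMap.intertwiningMap_of_isIntertwiningMap _ _ (symMap β.toLinearMap) fun g ↦ by
    refine LinearMap.congr_fun (f := symMap β.toLinearMap ∘ₗ sym2Rep ρP g)
      (g := sym2Rep ρT g ∘ₗ symMap β.toLinearMap) (symHom_ext fun u v ↦ ?_)
    have h (w : P) : β.toLinearMap (ρP g w) = ρT g (β.toLinearMap w) := β.isIntertwining _ _ g w
    simp [h]

/-- The cohomology of `S²(T)` with coefficients, when `T` is the quotient of a relatively projective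
representation by a split trivial subrepresentation with basis `a`. -/
theorem nonempty_linearEquiv_sym2 [Fintype G] (hodd : Odd (Fintype.card G))
    (hP : ρP.IsRelProjective) (β : ρP.IntertwiningMap ρT) {a : ι → P}
    (ha : ∀ g i, ρP g (a i) = a i) (hβa : ∀ i, β (a i) = 0) {r : ι → P →ₗ[k] k}
    (hr : ∀ i j, r i (a j) = if i = j then 1 else 0) {s : T →ₗ[k] P}
    (hβs : β.toLinearMap ∘ₗ s = LinearMap.id) (hsβ : ∀ v, s (β v) = v - ∑ i, r i v • a i)
    (ρA : Representation k G A) {n : ℕ} (hn : 1 ≤ n) :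
    Nonempty (groupCohomology (Rep.of ((sym2Rep ρT).tprod ρA)) n ≃ₗ[k]
      ((Σ i : ι, Finset.Ioi i) → groupCohomology (Rep.of ρA) (n + 2))) := by
  have h₂₂ := congr(LinearMap.rTensor A $(h₂_comp_d₂ hr))
  have hsym : symMap β.toLinearMap ∘ₗ symMap s = LinearMap.id :=
    symHom_ext fun u v ↦ by
      have h (w : T) : β.toLinearMap (s w) = w := congr($hβs w)
      simp [h]
  have hsym' : symMap s ∘ₗ symMap β.toLinearMap = symMap (s ∘ₗ β.toLinearMap) :=
    symHom_ext fun u v ↦ by simp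
  have h₀₀ := congr(LinearMap.rTensor A $hsym)
  have hd : symMap β.toLinearMap ∘ₗ d₁ a = 0 := by
    have h (i : ι) : β.toLinearMap (a i) = 0 := hβa i
    exact LinearMap.ext fun x ↦ by simp [d₁_apply, h]
  rw [LinearMap.rTensor_comp, LinearMap.rTensor_id] at h₂₂ h₀₀
  obtain ⟨e⟩ := nonempty_iso_add_two ((d₂Hom ρP ha).rTensor ρA) ((d₁Hom ρP ha).rTensor ρA)
    ((symMapHom β).rTensor ρA) (Function.LeftInverse.injective fun x ↦ congr($h₂₂ x))
    (Function.Exact.rTensor_of_homotopy d₁_comp_d₂ (d₂_comp_h₂ hr) A)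
    (Function.Exact.rTensor_of_homotopy hd (by
      rw [hsym']
      exact d₁_comp_h₁ hsβ) A)
    (Function.RightInverse.surjective fun x ↦ congr($h₀₀ x))
    ((hP.compLeft ι).tprod ρA) ((hP.sym2Rep hodd).tprod ρA) hn
  obtain ⟨e'⟩ := nonempty_linearEquiv_pi (J := Σ i : ι, Finset.Ioi i) ρA (n + 2)
  exact ⟨e.toLinearEquiv.trans e'⟩

end

theorem card_sigma_Ioi (n : ℕ) :
    Fintype.card (Σ i : Fin n, Finset.Ioi i) = n * (n - 1) / 2 := by
  simp only [Fintype.card_sigma, Fintype.card_coe, Fin.card_Ioi]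
  rw [Fin.sum_univ_eq_sum_range (fun i ↦ n - 1 - i), Finset.sum_range_reflect (fun i ↦ i),
    Finset.sum_range_id]

/-- **Statement 14.** Let `G` be a finite group of odd order and let
`0 → ℤⁿ → P → T → 0` be a short exact sequence of `G`-modules, finitely generated free as
abelian groups, where `ℤⁿ` has the trivial `G`-action and `P` is a finitely generated free
`ℤ[G]`-module.  Then for every `G`-module `A` and every `i ≥ 1`,
`Hⁱ(G, S²(T) ⊗ℤ A) ≅ H^{i+2}(G, A)^{⊕ n(n−1)/2}` (diagonal action on `S²(T) ⊗ℤ A`). -/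
theorem statement14 {G : Type} [Group G] [Fintype G] (hodd : Odd (Fintype.card G))
    (n : ℕ)
    {P : Type} [AddCommGroup P] (ρP : Representation ℤ G P)
    [Module.Free ℤ P] [Module.Finite ℤ P]
    (hfree : Module.Free (MonoidAlgebra ℤ G) ρP.asModule)
    (hfin : Module.Finite (MonoidAlgebra ℤ G) ρP.asModule)
    {T : Type} [AddCommGroup T] (ρT : Representation ℤ G T)
    [Module.Free ℤ T] [Module.Finite ℤ T]
    (α : (Fin n → ℤ) →ₗ[ℤ] P) (β : P →ₗ[ℤ] T)
    (hαeq : ∀ (g : G) (v : Fin n → ℤ), ρP g (α v) = α v)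
    (hβeq : ∀ (g : G) (p : P), β (ρP g p) = ρT g (β p))
    (hα : Function.Injective α) (hβ : Function.Surjective β)
    (hαβ : Function.Exact α β)
    {A : Type} [AddCommGroup A] (ρA : Representation ℤ G A) (i : ℕ) (hi : 1 ≤ i) :
    Nonempty ((groupCohomology (Rep.of ((sym2Rep ρT).tprod ρA)) i) ≃ₗ[ℤ]
      (Fin (n * (n - 1) / 2) → groupCohomology (Rep.of ρA) (i + 2))) := by
  have hP : ρP.IsRelProjective := ρP.isRelProjective_of_free
  obtain ⟨s, hs⟩ := Module.projective_lifting_property β LinearMap.id hβ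
  have hs' (t : T) : β (s t) = t := congr($hs t)
  let l : P →ₗ[ℤ] Fin n → ℤ := (LinearEquiv.ofInjective α hα).symm ∘ₗ
    (LinearMap.id - s ∘ₗ β).codRestrict (LinearMap.range α) fun v ↦ (hαβ _).1 (by simp [hs'])
  have hl (v : P) : α (l v) = v - s (β v) :=
    congrArg Subtype.val ((LinearEquiv.ofInjective α hα).apply_symm_apply _)
  let βG : ρP.IntertwiningMap ρT := LinearMap.intertwiningMap_of_isIntertwiningMap _ _ β hβeq
  let a (j : Fin n) : P := α (Pi.single j 1)
  have hβa (j : Fin n) : β (a j) = 0 := hαβ.apply_apply_eq_zero _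
  have hla (j : Fin n) : l (a j) = Pi.single j 1 := hα (by rw [hl, hβa, map_zero, sub_zero])
  obtain ⟨e⟩ := nonempty_linearEquiv_sym2 hodd hP βG (a := a) (fun g j ↦ hαeq g _) hβa
    (r := fun j ↦ LinearMap.proj j ∘ₗ l) (fun i j ↦ by simp [hla, Pi.single_apply]) hs
    (fun v ↦ by
      have : ∑ j, l v j • a j = α (l v) := by
        simp_rw [a, ← map_smul, ← map_sum]
        congr 1
        exact (pi_eq_sum_univ' (l v)).symm
      change s (β v) = v - ∑ j, l v j • a j
      rw [this, hl, sub_sub_cancel]) ρA hi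
  convert Nonempty.intro (e.trans (LinearEquiv.funCongrLeft ℤ
    (groupCohomology (Rep.of ρA) (i + 2)) (Fintype.equivFinOfCardEq (card_sigma_Ioi n)).symm))
  · rfl
  · exact Subsingleton.elim _ _

end
end
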